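/- arXiv:2312.04845 — 9 statements merged into one kernel-verified Lean document; each statement's English description precedes it below -/
import Mathlib

section
/- Let A ∈ ℝ^{n×n}, B ∈ ℝ^{n×m}, C ∈ ℝ^{Q×n}, and let x : ℕ → ℝ^n, u : ℕ → ℝ^m satisfy x(k+1) = A x(k) + B u(k) for all k, with output z(k) = C x(k). Suppose the pair (A,C) is not observable, i.e., the order-n observability matrix O_n = [C; CA; …; C A^{n−1}] ∈ ℝ^{nQ×n} has rank at most n−1, and suppose n ≤ Q. Then for every T ≥ 1, the Hankel matrix of depth n of z starting at 0 with T columns, Z ∈ ℝ^{nQ×T}, has rank strictly less than nQ. -/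
open Matrix

/-- The Hankel matrix of depth `t` of a signal `w : ℕ → ℝ^q`, starting at time `i`,
with `N` columns: its `(p, c)` block entry (`0 ≤ p < t`, `0 ≤ c < N`) is `w (i+p+c)`. -/
def hankel {q : ℕ} (w : ℕ → Fin q → ℝ) (i t N : ℕ) :
    Matrix (Fin t × Fin q) (Fin N) ℝ :=
  Matrix.of fun p c => w (i + (p.1 : ℕ) + (c : ℕ)) p.2

/-- A real matrix has deficient row rank iff some nonzero vector annihilates it from the left. -/
theorem rank_lt_card_rows_iff_exists_vecMul_eq_zero {ι κ : Type*} [Fintype ι] [Fintype κ]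
    (M : Matrix ι κ ℝ) :
    M.rank < Fintype.card ι ↔ ∃ v : ι → ℝ, v ≠ 0 ∧ v ᵥ* M = 0 := by
  have h : LinearIndependent ℝ M.row ↔ M.rank = Fintype.card ι := by
    rw [linearIndependent_iff_card_eq_finrank_span, M.rank_eq_finrank_span_row, eq_comm]
    rfl
  have h' : M.rank < Fintype.card ι ↔ ¬ LinearIndependent ℝ M.row := by
    rw [h]
    exact M.rank_le_card_height.lt_iff_ne
  rw [h', ← Matrix.vecMul_injective_iff, ← Matrix.coe_vecMulLinear, ← LinearMap.ker_eq_bot,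
    LinearMap.ker_eq_bot']
  push Not
  simp only [Matrix.vecMulLinear_apply, and_comm]

/-- If the pair `(A, C)` is not observable (the order-`n`
observability matrix has rank at most `n - 1`) and `n ≤ Q`, then for every
`T ≥ 1` the depth-`n` output Hankel matrix has rank strictly less than `n * Q`. -/
theorem statement2 {n m Q : ℕ} (hn : 0 < n)
    (A : Matrix (Fin n) (Fin n) ℝ) (B : Matrix (Fin n) (Fin m) ℝ)
    (C : Matrix (Fin Q) (Fin n) ℝ)
    (x : ℕ → Fin n → ℝ) (u : ℕ → Fin m → ℝ) (z : ℕ → Fin Q → ℝ)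
    (hdyn : ∀ k, x (k + 1) = A.mulVec (x k) + B.mulVec (u k))
    (hout : ∀ k, z k = C.mulVec (x k))
    (On : Matrix (Fin n × Fin Q) (Fin n) ℝ)
    (hOn : ∀ (p : Fin n × Fin Q) (j : Fin n), On p j = (C * A ^ (p.1 : ℕ)) p.2 j)
    (hnotobs : On.rank ≤ n - 1)
    (hnQ : n ≤ Q) :
    ∀ T : ℕ, 1 ≤ T → (hankel z 0 n T).rank < n * Q := by
  intro T _
  have hC : C.rank < Fintype.card (Fin Q) := by
    have hsub : C = On.submatrix (fun q => (⟨0, hn⟩, q)) (Equiv.refl (Fin n)) := by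
      ext q j
      simp [hOn]
    have hle : C.rank ≤ On.rank := by
      rw [hsub]
      exact Matrix.rank_submatrix_le _ _ _
    rw [Fintype.card_fin]
    omega
  obtain ⟨v, hv, hvC⟩ := (rank_lt_card_rows_iff_exists_vecMul_eq_zero C).1 hC
  have hcard : n * Q = Fintype.card (Fin n × Fin Q) := by simp
  rw [hcard, rank_lt_card_rows_iff_exists_vecMul_eq_zero]
  refine ⟨fun p => if p.1 = ⟨0, hn⟩ then v p.2 else 0, fun h => hv ?_, ?_⟩
  · ext q
    simpa using congrFun h (⟨0, hn⟩, q)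
  · ext c
    have hz : v ⬝ᵥ z c = 0 := by
      rw [hout, Matrix.dotProduct_mulVec, hvC, zero_dotProduct]
    simpa [Matrix.vecMul, dotProduct, hankel, Fintype.sum_prod_type_right, ite_mul] using hz
end

section
/- Let A ∈ ℝ^{n×n}, B ∈ ℝ^{n×m}, C ∈ ℝ^{Q×n}, and let x : ℕ → ℝ^n, u : ℕ → ℝ^m satisfy x(k+1) = A x(k) + B u(k) for all k, with output z(k) = C x(k). Let ñ = (m+Q)n + 1, let T ≥ (m+1)ñ, and suppose the input segment u(n),…,u(n+T−1) is persistently exciting of order ñ. Let M₀ ∈ ℝ^{(m(n+1)+Qn)×T} be the matrix obtained by stacking: (i) the m×T matrix with columns u(n),…,u(n+T−1); (ii) the Hankel matrix of depth n of z starting at 0 with T columns; and (iii) the Hankel matrix of depth n of u starting at 0 with T columns. If the pair (A,C) is not observable and n < Q+1, then rank M₀ ≠ m(n+1) + Qn (in fact rank M₀ < m(n+1) + Qn). -/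
open Matrix

/-- The state `p ≤ N` steps ahead is `A ^ p` applied to the current state plus a fixed linear
function of the next `N` inputs. -/
theorem exists_state_eq {n m : ℕ} {A : Matrix (Fin n) (Fin n) ℝ} {B : Matrix (Fin n) (Fin m) ℝ}
    {x : ℕ → Fin n → ℝ} {u : ℕ → Fin m → ℝ}
    (hdyn : ∀ k, x (k + 1) = A.mulVec (x k) + B.mulVec (u k)) (N p : ℕ) (hp : p ≤ N) :
    ∃ G : Matrix (Fin n) (Fin N × Fin m) ℝ, ∀ c,
      x (p + c) = (A ^ p) *ᵥ x c + G *ᵥ fun s : Fin N × Fin m => u (s.1 + c) s.2 := by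
  induction p with
  | zero => exact ⟨0, fun c => by simp⟩
  | succ p ih =>
    obtain ⟨G, hG⟩ := ih (by omega)
    let S : Matrix (Fin m) (Fin N × Fin m) ℝ :=
      Matrix.of fun i s => Pi.single (M := fun _ => ℝ) ((⟨p, hp⟩ : Fin N), i) 1 s
    have hS (c : ℕ) : S *ᵥ (fun s : Fin N × Fin m => u (s.1 + c) s.2) = u (p + c) := by
      ext i
      exact single_one_dotProduct _ _
    refine ⟨A * G + B * S, fun c => ?_⟩
    rw [show p + 1 + c = p + c + 1 by omega, hdyn, hG, add_mulVec, ← mulVec_mulVec,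
      ← mulVec_mulVec, hS, mulVec_add, mulVec_mulVec, ← pow_succ', add_assoc]

/-- A matrix with a nonzero vector in its left kernel does not have full row rank. -/
theorem rank_lt_card_of_vecMul_eq_zero {ι κ : Type*} [Fintype ι] [Fintype κ]
    (M : Matrix ι κ ℝ) (v : ι → ℝ) (hv : v ≠ 0) (h : v ᵥ* M = 0) :
    M.rank < Fintype.card ι := by
  refine lt_of_le_of_ne M.rank_le_card_height fun hr => hv ?_
  have hli : LinearIndependent ℝ M.row := by
    rw [linearIndependent_iff_card_eq_finrank_span, ← hr, M.rank_eq_finrank_span_row]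
    rfl
  exact Matrix.vecMul_injective_iff.mpr hli (by simpa using h)

/-- A matrix without full row rank has a nonzero vector in its left kernel. -/
theorem exists_vecMul_eq_zero_of_rank_lt_card {ι κ : Type*} [Fintype ι] [Fintype κ]
    (M : Matrix ι κ ℝ) (h : M.rank < Fintype.card ι) :
    ∃ v : ι → ℝ, v ≠ 0 ∧ v ᵥ* M = 0 := by
  by_contra! hc
  have hli : LinearIndependent ℝ M.row := by
    rw [← Matrix.vecMul_injective_iff]
    intro a b hab
    by_contra hne
    exact hc (a - b) (sub_ne_zero.mpr hne) (by rw [sub_vecMul]; exact sub_eq_zero.mpr hab)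
  exact h.ne hli.rank_matrix

/-- If the pair `(A, C)` is not observable and `n < Q + 1`, then the
stacked data matrix `M₀ = [U_{n,T}; Z_{0,n,T}; U_{0,n,T}]` cannot have full row rank
`m(n+1) + Qn`, even when the input is persistently exciting of order
`ñ = (m+Q)n + 1` and `T ≥ (m+1)ñ`. -/
theorem statement3 {n m Q T : ℕ}
    (A : Matrix (Fin n) (Fin n) ℝ) (B : Matrix (Fin n) (Fin m) ℝ)
    (C : Matrix (Fin Q) (Fin n) ℝ)
    (x : ℕ → Fin n → ℝ) (u : ℕ → Fin m → ℝ) (z : ℕ → Fin Q → ℝ)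
    (hdyn : ∀ k, x (k + 1) = A.mulVec (x k) + B.mulVec (u k))
    (hout : ∀ k, z k = C.mulVec (x k))
    (ntilde : ℕ) (hntilde : ntilde = (m + Q) * n + 1)
    (hT : (m + 1) * ntilde ≤ T)
    (hPE : (hankel u n ntilde (T - ntilde + 1)).rank = ntilde * m)
    (Un : Matrix (Fin m) (Fin T) ℝ) (hUn : ∀ i t, Un i t = u (n + (t : ℕ)) i)
    (M₀ : Matrix (Fin m ⊕ ((Fin n × Fin Q) ⊕ (Fin n × Fin m))) (Fin T) ℝ)
    (hM₀ : M₀ = Matrix.fromRows Un (Matrix.fromRows (hankel z 0 n T) (hankel u 0 n T)))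
    (On : Matrix (Fin n × Fin Q) (Fin n) ℝ)
    (hOn : ∀ (p : Fin n × Fin Q) (j : Fin n), On p j = (C * A ^ (p.1 : ℕ)) p.2 j)
    (hnotobs : On.rank ≠ n)
    (hnQ : n < Q + 1) :
    M₀.rank ≠ m * (n + 1) + Q * n ∧ M₀.rank < m * (n + 1) + Q * n := by
  have hlt : M₀.rank < m * (n + 1) + Q * n := by
    have hOn_lt : On.rank < n :=
      lt_of_le_of_ne (by simpa using On.rank_le_card_width) hnotobs
    have hOn_card : On.rank < Fintype.card (Fin n × Fin Q) := by
      simp only [Fintype.card_prod, Fintype.card_fin]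
      nlinarith
    obtain ⟨v, hv, hvO⟩ := exists_vecMul_eq_zero_of_rank_lt_card On hOn_card
    choose G hG using fun p : Fin n => exists_state_eq hdyn n p p.2.le
    let Γ : Matrix (Fin n × Fin Q) (Fin n × Fin m) ℝ := Matrix.of fun p => (C * G p.1) p.2
    have hZ : hankel z 0 n T =
        On * (Matrix.of fun j (c : Fin T) => x c j) + Γ * hankel u 0 n T := by
      ext p c
      have hOrow : On p = (C * A ^ (p.1 : ℕ)) p.2 := funext (hOn p)
      have hcol : (fun s => hankel u 0 n T s c) =
          fun s : Fin n × Fin m => u (s.1 + c) s.2 := by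
        ext s
        simp [hankel]
      have hz : hankel z 0 n T p c = (C *ᵥ x (p.1 + c)) p.2 := by
        simp [hankel, hout]
      rw [hz, hG, mulVec_add, mulVec_mulVec, mulVec_mulVec, Pi.add_apply, Matrix.add_apply,
        Matrix.mul_apply', Matrix.mul_apply', hcol, hOrow]
      rfl
    have hker : Sum.elim (0 : Fin m → ℝ) (Sum.elim v (-(v ᵥ* Γ))) ᵥ* M₀ = 0 := by
      rw [hM₀, sumElim_vecMul_fromRows, sumElim_vecMul_fromRows, hZ, vecMul_add,
        ← vecMul_vecMul, hvO, neg_vecMul, ← vecMul_vecMul]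
      simp
    have hne : Sum.elim (0 : Fin m → ℝ) (Sum.elim v (-(v ᵥ* Γ))) ≠ 0 := fun h =>
      hv (funext fun p => congrFun h (Sum.inr (Sum.inl p)))
    have hrank := rank_lt_card_of_vecMul_eq_zero M₀ _ hne hker
    simp only [Fintype.card_sum, Fintype.card_prod, Fintype.card_fin] at hrank
    linarith
  exact ⟨hlt.ne, hlt⟩
end

section
/- Let A ∈ ℝ^{n×n}, B ∈ ℝ^{n×m}, C ∈ ℝ^{p×n}, and suppose the pair (A,B) is controllable and the pair (A,C) is observable. Then there exist matrices Υ₁,…,Υ_n ∈ ℝ^{p×p} and Π₁,…,Π_n ∈ ℝ^{p×m} such that every triple of signals x : ℕ → ℝ^n, u : ℕ → ℝ^m, y : ℕ → ℝ^p with x(k+1) = A x(k) + B u(k) and y(k) = C x(k) for all k satisfies the ARX relation y(k) + Υ_n y(k−1) + Υ_{n−1} y(k−2) + … + Υ₁ y(k−n) = Π_n u(k−1) + Π_{n−1} u(k−2) + … + Π₁ u(k−n) for all k ≥ n. -/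
open Matrix

/-- The output of a linear system after `j` steps, as free response plus the sum of the
Markov parameters applied to the inputs. The sum runs over any range `n ≥ j`. -/
theorem output_eq_freeResponse_add_sum {ι κ μ R : Type*} [Fintype ι] [DecidableEq ι]
    [Fintype κ] [CommRing R]
    (A : Matrix ι ι R) (B : Matrix ι κ R) (C : Matrix μ ι R)
    {x : ℕ → ι → R} {u : ℕ → κ → R}
    (hx : ∀ k, x (k + 1) = A.mulVec (x k) + B.mulVec (u k)) (t : ℕ) {j n : ℕ} (hj : j ≤ n) :
    C.mulVec (x (t + j)) = (C * A ^ j).mulVec (x t) +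
      ∑ l : Fin n, (if (l : ℕ) < j then C * A ^ (j - 1 - l) * B else 0).mulVec (u (t + l)) := by
  induction j generalizing C with
  | zero => simp
  | succ j ih =>
    have hsum : ∑ l : Fin n, (if (l : ℕ) < j + 1 then C * A ^ (j + 1 - 1 - l) * B else 0).mulVec
          (u (t + l)) =
        ∑ l : Fin n, (if (l : ℕ) < j then C * A * A ^ (j - 1 - l) * B else 0).mulVec (u (t + l)) +
          (C * B).mulVec (u (t + j)) := by
      have hlast : (C * B).mulVec (u (t + j)) =
          ∑ l : Fin n, if l = ⟨j, hj⟩ then (C * B).mulVec (u (t + l)) else 0 := by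
        simp
      rw [hlast, ← Finset.sum_add_distrib]
      refine Finset.sum_congr rfl fun l _ => ?_
      rcases lt_trichotomy (l : ℕ) j with h | h | h
      · have hpow : j + 1 - 1 - (l : ℕ) = j - 1 - l + 1 := by omega
        rw [if_pos (by omega), if_pos h, if_neg (by simp [Fin.ext_iff, h.ne]), add_zero, hpow,
          pow_succ', Matrix.mul_assoc C A]
      · simp [Fin.ext_iff, h]
      · rw [if_neg (by omega), if_neg (by omega), if_neg (by simp [Fin.ext_iff, h.ne']), add_zero]
    rw [← add_assoc t j 1, hx, mulVec_add, mulVec_mulVec, mulVec_mulVec, ih (C * A) (by omega),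
      hsum, Matrix.mul_assoc C A, ← pow_succ', add_assoc]

/-- Every controllable and observable state-space model `(A, B, C)`
admits an equivalent ARX representation: there exist matrices `Υ₁,…,Υₙ` and
`Π₁,…,Πₙ` (here `Υ i` stands for `Υ_{i+1}` and `Pmat i` for `Π_{i+1}`, `i : Fin n`)
such that every trajectory satisfies
`y(k) + Υₙ y(k−1) + … + Υ₁ y(k−n) = Pmatₙ u(k−1) + … + Pmat₁ u(k−n)` for all `k ≥ n`. -/
theorem statement4 {n m p : ℕ}
    (A : Matrix (Fin n) (Fin n) ℝ) (B : Matrix (Fin n) (Fin m) ℝ)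
    (C : Matrix (Fin p) (Fin n) ℝ)
    (hctrb : (Matrix.of fun (r : Fin n) (c : Fin n × Fin m) =>
      (A ^ (c.1 : ℕ) * B) r c.2).rank = n)
    (hobs : (Matrix.of fun (r : Fin n × Fin p) (c : Fin n) =>
      (C * A ^ (r.1 : ℕ)) r.2 c).rank = n) :
    ∃ (Υ : Fin n → Matrix (Fin p) (Fin p) ℝ) (Pmat : Fin n → Matrix (Fin p) (Fin m) ℝ),
      ∀ (x : ℕ → Fin n → ℝ) (u : ℕ → Fin m → ℝ) (y : ℕ → Fin p → ℝ),
        (∀ k, x (k + 1) = A.mulVec (x k) + B.mulVec (u k)) →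
        (∀ k, y k = C.mulVec (x k)) →
        ∀ k, n ≤ k →
          y k + ∑ i : Fin n, (Υ i).mulVec (y (k - n + (i : ℕ))) =
            ∑ i : Fin n, (Pmat i).mulVec (u (k - n + (i : ℕ))) := by
  classical
  set c : ℕ → ℝ := A.charpoly.coeff
  have hdeg : A.charpoly.natDegree = n := by simp [A.charpoly_natDegree_eq_dim]
  have hcn : c n = 1 := by
    simpa [Polynomial.leadingCoeff, hdeg] using A.charpoly_monic.leadingCoeff
  have hCH : ∑ j ∈ Finset.range (n + 1), c j • A ^ j = 0 := by
    have h := A.aeval_self_charpoly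
    rwa [Polynomial.aeval_eq_sum_range, hdeg] at h
  refine ⟨fun i => c i • 1, fun l => ∑ j ∈ Finset.range (n + 1),
    c j • (if (l : ℕ) < j then C * A ^ (j - 1 - l) * B else 0), ?_⟩
  intro x u y hx hy k hk
  obtain ⟨t, rfl⟩ := Nat.exists_eq_add_of_le' hk
  simp only [Nat.add_sub_cancel]
  have hlhs : y (t + n) + ∑ i : Fin n, (c i • (1 : Matrix (Fin p) (Fin p) ℝ)).mulVec (y (t + i)) =
      ∑ j ∈ Finset.range (n + 1), c j • y (t + j) := by
    rw [Finset.sum_range_succ, hcn, one_smul, add_comm,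
      Finset.sum_range fun j => c j • y (t + j)]
    simp [smul_mulVec]
  have hfree : ∑ j ∈ Finset.range (n + 1), c j • (C * A ^ j).mulVec (x t) = 0 := by
    simp_rw [← smul_mulVec, ← Matrix.mul_smul]
    rw [← sum_mulVec, ← Matrix.mul_sum, hCH, Matrix.mul_zero, zero_mulVec]
  rw [hlhs]
  have hstep : ∀ j ∈ Finset.range (n + 1), c j • y (t + j) = c j • (C * A ^ j).mulVec (x t) +
      ∑ l : Fin n, (c j • (if (l : ℕ) < j then C * A ^ (j - 1 - l) * B else 0)).mulVec
        (u (t + l)) := by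
    intro j hj
    rw [hy, output_eq_freeResponse_add_sum A B C hx t (Finset.mem_range_succ_iff.mp hj), smul_add,
      Finset.smul_sum]
    simp_rw [smul_mulVec]
  rw [Finset.sum_congr rfl hstep, Finset.sum_add_distrib, hfree, zero_add, Finset.sum_comm]
  simp_rw [sum_mulVec]
end

section
/- Let A ∈ ℝ^{n×n}, B ∈ ℝ^{n×m}, C ∈ ℝ^{Q×n} with (A,B) controllable and (A,C) observable, and let x : ℕ → ℝ^n, u : ℕ → ℝ^m satisfy x(k+1) = A x(k) + B u(k), with output z(k) = C x(k). For k ≥ n let 𝒳(k) = (z(k−n), …, z(k−1), u(k−n), …, u(k−1)) ∈ ℝ^{(Q+m)n} be the extended state. From the data build: Û ∈ ℝ^{m×T} with columns u(n),…,u(n+T−1); X̂₀ ∈ ℝ^{(Q+m)n×T} with columns 𝒳(n),…,𝒳(n+T−1); and X̂₁ ∈ ℝ^{(Q+m)n×T} with columns 𝒳(n+1),…,𝒳(n+T). Suppose rank [Û; X̂₀] = m(n+1) + Qn. Then for every matrix G ∈ ℝ^{T×(m(n+1)+Qn)} with [Û; X̂₀]·G = I, the matrix Λ = X̂₁·G satisfies: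 for every other trajectory x' : ℕ → ℝ^n, u' : ℕ → ℝ^m of the same system with output z'(k) = C x'(k) and extended state 𝒳'(k) = (z'(k−n),…,z'(k−1),u'(k−n),…,u'(k−1)), one has 𝒳'(k+1) = Λ·(u'(k), 𝒳'(k)) for all k ≥ n. -/
open Matrix

/-- The extended state of depth `n` at time `k ≥ n` built from an output signal
`z : ℕ → ℝ^Q` and an input signal `u : ℕ → ℝ^m`:
`𝒳(k) = (z(k−n), …, z(k−1), u(k−n), …, u(k−1)) ∈ ℝ^{(Q+m)n}`. -/
def extState {Q m : ℕ} (n : ℕ) (z : ℕ → Fin Q → ℝ) (u : ℕ → Fin m → ℝ) (k : ℕ) :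
    (Fin n × Fin Q) ⊕ (Fin n × Fin m) → ℝ :=
  Sum.elim (fun q => z (k - n + (q.1 : ℕ)) q.2) (fun q => u (k - n + (q.1 : ℕ)) q.2)

/-- A matrix of full column rank has trivial kernel. -/
theorem Matrix.eq_zero_of_mulVec_eq_zero_of_rank_eq_card {K ι κ : Type*} [Field K] [Fintype ι]
    [Fintype κ] {M : Matrix ι κ K} (hM : M.rank = Fintype.card κ) {v : κ → K}
    (hv : M *ᵥ v = 0) : v = 0 := by
  have hdim := M.mulVecLin.finrank_range_add_finrank_ker
  rw [Module.finrank_fintype_fun_eq_card] at hdim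
  have hker : Module.finrank K (LinearMap.ker M.mulVecLin) = 0 := by
    have : Module.finrank K (LinearMap.range M.mulVecLin) = Fintype.card κ := hM
    omega
  rw [Submodule.finrank_eq_zero] at hker
  have hmem : v ∈ LinearMap.ker M.mulVecLin := by simpa using hv
  simpa [hker] using hmem

/-- For an observable system, a trajectory whose input and output vanish on the first `n` steps
has zero state up to time `n`. -/
theorem state_eq_zero_of_observable {n m Q : ℕ}
    {A : Matrix (Fin n) (Fin n) ℝ} {B : Matrix (Fin n) (Fin m) ℝ} {C : Matrix (Fin Q) (Fin n) ℝ}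
    (hobs : (Matrix.of fun (r : Fin n × Fin Q) (c : Fin n) =>
      (C * A ^ (r.1 : ℕ)) r.2 c).rank = n)
    {e : ℕ → Fin n → ℝ} {v : ℕ → Fin m → ℝ}
    (hdyn : ∀ j, e (j + 1) = A *ᵥ e j + B *ᵥ v j)
    (hv : ∀ j < n, v j = 0) (hout : ∀ j < n, C *ᵥ e j = 0) :
    ∀ j ≤ n, e j = 0 := by
  have hpow : ∀ j ≤ n, e j = (A ^ j) *ᵥ e 0 := by
    intro j
    induction j with
    | zero => simp
    | succ j ih =>
      intro hj
      rw [hdyn, hv j hj, ih (by omega), mulVec_zero, add_zero, mulVec_mulVec, pow_succ']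
  have h0 : e 0 = 0 := by
    refine Matrix.eq_zero_of_mulVec_eq_zero_of_rank_eq_card (hobs.trans (by simp)) ?_
    ext r
    have h := hout r.1 r.1.2
    rw [hpow r.1 r.1.2.le, mulVec_mulVec] at h
    exact congrFun h r.2
  intro j hj
  rw [hpow j hj, h0, mulVec_zero]

/-- Data-driven representation in terms of the extended state:
if the stacked data matrix `[Û; X̂₀]` built from one attack-free trajectory has full
row rank `m(n+1) + Qn`, then for every right inverse `G` of it, the matrix
`Λ = X̂₁ G` reproduces the extended-state dynamics of every trajectory of the system:
`𝒳'(k+1) = Λ (u'(k), 𝒳'(k))` for all `k ≥ n`. -/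
theorem statement6 {n m Q T : ℕ}
    (A : Matrix (Fin n) (Fin n) ℝ) (B : Matrix (Fin n) (Fin m) ℝ)
    (C : Matrix (Fin Q) (Fin n) ℝ)
    (hctrb : (Matrix.of fun (r : Fin n) (c : Fin n × Fin m) =>
      (A ^ (c.1 : ℕ) * B) r c.2).rank = n)
    (hobs : (Matrix.of fun (r : Fin n × Fin Q) (c : Fin n) =>
      (C * A ^ (r.1 : ℕ)) r.2 c).rank = n)
    (x : ℕ → Fin n → ℝ) (u : ℕ → Fin m → ℝ) (z : ℕ → Fin Q → ℝ)
    (hdyn : ∀ k, x (k + 1) = A.mulVec (x k) + B.mulVec (u k))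
    (hout : ∀ k, z k = C.mulVec (x k))
    (Uhat : Matrix (Fin m) (Fin T) ℝ) (hUhat : ∀ i t, Uhat i t = u (n + (t : ℕ)) i)
    (X₀hat : Matrix ((Fin n × Fin Q) ⊕ (Fin n × Fin m)) (Fin T) ℝ)
    (hX₀hat : ∀ idx t, X₀hat idx t = extState n z u (n + (t : ℕ)) idx)
    (X₁hat : Matrix ((Fin n × Fin Q) ⊕ (Fin n × Fin m)) (Fin T) ℝ)
    (hX₁hat : ∀ idx t, X₁hat idx t = extState n z u (n + (t : ℕ) + 1) idx)
    (hrank : (Matrix.fromRows Uhat X₀hat).rank = m * (n + 1) + Q * n) :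
    ∀ G : Matrix (Fin T) (Fin m ⊕ ((Fin n × Fin Q) ⊕ (Fin n × Fin m))) ℝ,
      Matrix.fromRows Uhat X₀hat * G = 1 →
      ∀ (x' : ℕ → Fin n → ℝ) (u' : ℕ → Fin m → ℝ) (z' : ℕ → Fin Q → ℝ),
        (∀ k, x' (k + 1) = A.mulVec (x' k) + B.mulVec (u' k)) →
        (∀ k, z' k = C.mulVec (x' k)) →
        ∀ k, n ≤ k →
          extState n z' u' (k + 1) =
            (X₁hat * G).mulVec (Sum.elim (u' k) (extState n z' u' k)) := by
  intro G hG x' u' z' hdyn' hout' k hk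
  set w := G *ᵥ Sum.elim (u' k) (extState n z' u' k) with hw
  have hdata : fromRows Uhat X₀hat *ᵥ w = Sum.elim (u' k) (extState n z' u' k) := by
    rw [hw, mulVec_mulVec, hG, one_mulVec]
  let e : ℕ → Fin n → ℝ := fun j => ∑ t : Fin T, w t • x (t + j) - x' (k - n + j)
  let v : ℕ → Fin m → ℝ := fun j => ∑ t : Fin T, w t • u (t + j) - u' (k - n + j)
  have he : ∀ j, e (j + 1) = A *ᵥ e j + B *ᵥ v j := by
    intro j
    simp only [e, v, ← add_assoc, hdyn, hdyn', mulVec_sub, mulVec_sum, mulVec_smul, smul_add,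
      Finset.sum_add_distrib]
    abel
  have hCe : ∀ j q, (C *ᵥ e j) q = ∑ t : Fin T, w t * z (t + j) q - z' (k - n + j) q := by
    intro j q
    simp [e, hout, hout', mulVec_sub, mulVec_sum, mulVec_smul]
  have hvapply : ∀ j i, v j i = ∑ t : Fin T, w t * u (t + j) i - u' (k - n + j) i := by
    intro j i
    simp [v]
  have hv : ∀ j ≤ n, v j = 0 := by
    intro j hj
    ext i
    rw [hvapply, Pi.zero_apply, sub_eq_zero]
    rcases hj.lt_or_eq with hj | rfl
    · have h := congrFun hdata (Sum.inr (Sum.inr (⟨j, hj⟩, i)))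
      simpa [mulVec, dotProduct, hX₀hat, extState, mul_comm] using h
    · have h := congrFun hdata (Sum.inl i)
      simpa [mulVec, dotProduct, hUhat, mul_comm, add_comm, Nat.add_sub_cancel' hk] using h
  have hout₀ : ∀ j < n, C *ᵥ e j = 0 := by
    intro j hj
    ext q
    rw [hCe, Pi.zero_apply, sub_eq_zero]
    have h := congrFun hdata (Sum.inr (Sum.inl (⟨j, hj⟩, q)))
    simpa [mulVec, dotProduct, hX₀hat, extState, mul_comm] using h
  have hzero := state_eq_zero_of_observable hobs he (fun j hj => hv j hj.le) hout₀
  have hk₁ : ∀ i, k + 1 - n + i = k - n + (i + 1) := by omega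
  have hn₁ : ∀ t i, n + t + 1 - n + i = t + (i + 1) := by omega
  rw [← mulVec_mulVec, ← hw]
  ext (⟨i, q⟩ | ⟨i, q⟩)
  · have h := hCe (i + 1) q
    rw [hzero _ i.2, mulVec_zero, Pi.zero_apply, eq_comm, sub_eq_zero] at h
    simp [mulVec, dotProduct, hX₁hat, extState, hk₁, hn₁, ← h, mul_comm]
  · have h := hvapply (i + 1) q
    rw [hv _ i.2, Pi.zero_apply, eq_comm, sub_eq_zero] at h
    simp [mulVec, dotProduct, hX₁hat, extState, hk₁, hn₁, ← h, mul_comm]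
end

section
/- Let z : ℕ → ℝ^Q be a signal and suppose there exist an index l ∈ {1,…,Q} and a constant c ∈ ℝ such that the l-th component of z(k) equals c for all 0 ≤ k ≤ n+T−2. Then the Hankel matrix of depth n of z starting at 0 with T columns, Z ∈ ℝ^{nQ×T}, has rank at most n(Q−1) + 1. In particular, if n ≥ 2 then rank Z < nQ. -/
open Matrix

/-- A matrix whose rows indexed by `ι × {l}` all coincide has rank at most one more than the
number of remaining rows. -/
theorem rank_le_of_rows_eq {R ι κ k : Type*} [CommSemiring R] [StrongRankCondition R]
    [Fintype ι] [Fintype κ] [DecidableEq κ] [Fintype k]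
    (M : Matrix (ι × κ) k R) (l : κ) (r : k → R) (h : ∀ i, M (i, l) = r) :
    M.rank ≤ Fintype.card ι * (Fintype.card κ - 1) + 1 := by
  let B : Matrix (ι × {j // j ≠ l} ⊕ Unit) k R :=
    Matrix.of (Sum.elim (fun p => M (p.1, p.2)) fun _ => r)
  let f : ι × κ → ι × {j // j ≠ l} ⊕ Unit := fun p =>
    if hp : p.2 = l then Sum.inr () else Sum.inl (p.1, ⟨p.2, hp⟩)
  have hM : M = B.submatrix f id := by
    ext ⟨i, j⟩ a
    by_cases hj : j = l
    · subst hj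
      simp [B, f, h]
    · simp [B, f, hj]
  calc M.rank ≤ B.rank := by
        rw [hM]
        exact B.rank_submatrix_le f id
    _ ≤ Fintype.card (ι × {j // j ≠ l} ⊕ Unit) := B.rank_le_card_height
    _ = Fintype.card ι * (Fintype.card κ - 1) + 1 := by
        simp [Fintype.card_subtype_compl]

/-- If some component `l` of the signal `z : ℕ → ℝ^Q` is constant
equal to `c` on `0 ≤ k ≤ n+T−2`, then the depth-`n` Hankel matrix of `z` with `T`
columns has rank at most `n(Q−1) + 1`; in particular, its rank is strictly less than
`nQ` whenever `n ≥ 2`. -/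
theorem statement7 {Q n T : ℕ}
    (z : ℕ → Fin Q → ℝ) (l : Fin Q) (c : ℝ)
    (hconst : ∀ k, k ≤ n + T - 2 → z k l = c) :
    (hankel z 0 n T).rank ≤ n * (Q - 1) + 1 ∧
      (2 ≤ n → (hankel z 0 n T).rank < n * Q) := by
  have hrank : (hankel z 0 n T).rank ≤ n * (Q - 1) + 1 := by
    simpa using rank_le_of_rows_eq (hankel z 0 n T) l (fun _ => c) fun p => by
      ext a
      exact hconst _ (by omega)
  refine ⟨hrank, fun hn => hrank.trans_lt ?_⟩
  obtain ⟨q, rfl⟩ := Nat.exists_eq_succ_of_ne_zero l.pos.ne'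
  simp only [Nat.succ_eq_add_one, Nat.add_sub_cancel, mul_add, mul_one]
  omega
end

section
/- Let n ≥ 2, let u : ℕ → ℝ^m be any input signal, and let z̃ : ℕ → ℝ^Q be a measured output signal that is under replay attack in at least one channel, i.e., there exist an index l ∈ {1,…,Q} and a constant c ∈ ℝ with the l-th component of z̃(k) equal to c for all 0 ≤ k ≤ n+T−2. Let M₀ ∈ ℝ^{(m(n+1)+Qn)×T} be the matrix obtained by stacking: (i) the m×T matrix with columns u(n),…,u(n+T−1); (ii) the Hankel matrix of depth n of z̃ starting at 0 with T columns; and (iii) the Hankel matrix of depth n of u starting at 0 with T columns. Then rank M₀ < m(n+1) + Qn; in particular the rank condition rank M₀ = m(n+1) + Qn cannot hold. -/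
open Matrix

/-- A matrix with two equal rows does not have full row rank. -/
theorem Matrix.rank_lt_card_height_of_row_eq {m n K : Type*} [Fintype m] [Fintype n] [Field K]
    (A : Matrix m n K) {i j : m} (hij : i ≠ j) (h : A.row i = A.row j) :
    A.rank < Fintype.card m := by
  refine lt_of_le_of_ne A.rank_le_card_height fun hrank => hij ?_
  have hli : LinearIndependent K A.row := by
    rw [linearIndependent_iff_card_eq_finrank_span, Set.finrank, ← A.rank_eq_finrank_span_row,
      hrank]
  exact hli.injective h

/-- If `n ≥ 2` and the measured output `z̃` is under replay attack
on some channel `l` (that channel is constant on `0 ≤ k ≤ n+T−2`), then the stacked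
data matrix `M₀ = [U_{n,T}; Z̃_{0,n,T}; U_{0,n,T}]` has rank strictly less than
`m(n+1) + Qn`; in particular the full-row-rank condition cannot hold. -/
theorem statement8 {n m Q T : ℕ} (hn : 2 ≤ n)
    (u : ℕ → Fin m → ℝ) (ztilde : ℕ → Fin Q → ℝ)
    (l : Fin Q) (c : ℝ)
    (hreplay : ∀ k, k ≤ n + T - 2 → ztilde k l = c)
    (Un : Matrix (Fin m) (Fin T) ℝ) (hUn : ∀ i t, Un i t = u (n + (t : ℕ)) i)
    (M₀ : Matrix (Fin m ⊕ ((Fin n × Fin Q) ⊕ (Fin n × Fin m))) (Fin T) ℝ)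
    (hM₀ : M₀ = Matrix.fromRows Un
      (Matrix.fromRows (hankel ztilde 0 n T) (hankel u 0 n T))) :
    M₀.rank < m * (n + 1) + Q * n ∧ M₀.rank ≠ m * (n + 1) + Q * n := by
  suffices h : M₀.rank < m * (n + 1) + Q * n from ⟨h, h.ne⟩
  have hcard : Fintype.card (Fin m ⊕ ((Fin n × Fin Q) ⊕ (Fin n × Fin m))) =
      m * (n + 1) + Q * n := by
    simp only [Fintype.card_sum, Fintype.card_prod, Fintype.card_fin]
    ring
  rw [← hcard]
  refine M₀.rank_lt_card_height_of_row_eq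
    (i := Sum.inr (Sum.inl (⟨0, by omega⟩, l))) (j := Sum.inr (Sum.inl (⟨1, by omega⟩, l)))
    (by simp) ?_
  ext t
  have ht := t.isLt
  simp only [hM₀, Matrix.row, Matrix.fromRows_apply_inr, Matrix.fromRows_apply_inl, hankel,
    Matrix.of_apply]
  rw [hreplay _ (by omega), hreplay _ (by omega)]
end

section
/- Consider a single-input discrete-time LTI plant with N sensors: A ∈ ℝ^{n×n}, B ∈ ℝ^n, and row vectors C₁,…,C_N ∈ ℝ^{1×n}, with x(k+1) = A x(k) + B u(k), y_j(k) = C_j x(k) for j = 1,…,N, and x(0) = 0. Apply the impulse input u(0) = u₀ ≠ 0, u(k) = 0 for k ≥ 1. Suppose each sensor j has a well-defined relative degree r_j = 1 + min{ i ≥ 0 : C_j A^i B ≠ 0 }. Suppose each sensor j is subject to a delay attack with integer delay τ_j ≥ 0, producing ỹ_j(k) = y_j(k−τ_j) for k ≥ τ_j and ỹ_j(k) = 0 for k < τ_j, and define σ_j = min{ k ≥ 0 : ỹ_j(k) ≠ 0 }. If at least one sensor is attack-free (τ_j = 0 for some j), then the set of minimizers argmin_{j ∈ {1,…,N}} (σ_j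 − r_j) equals exactly the set { j : τ_j = 0 } of delay-attack-free sensors, and the minimum value is 0. -/
open Matrix

/-- The state of a system at rest after an impulse of size `u₀` at time `0`. -/
theorem state_impulse {n : ℕ} {A : Matrix (Fin n) (Fin n) ℝ} {B : Fin n → ℝ}
    {x : ℕ → Fin n → ℝ} {u : ℕ → ℝ} (hx0 : x 0 = 0)
    (hdyn : ∀ k, x (k + 1) = A.mulVec (x k) + u k • B) (hu : ∀ k, 1 ≤ k → u k = 0) (k : ℕ) :
    x (k + 1) = u 0 • (A ^ k).mulVec B := by
  induction k with
  | zero => simp [hdyn, hx0]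
  | succ k ih =>
    rw [hdyn, ih, hu (k + 1) (by omega), zero_smul, add_zero, mulVec_smul, mulVec_mulVec,
      ← pow_succ']

/-- Delaying a signal by `t` delays its first nonzero time by `t`. -/
theorem sInf_delay_ne_zero {y z : ℕ → ℝ} {t m : ℕ}
    (hz : ∀ k, z k = if k < t then 0 else y (k - t))
    (hm : y m ≠ 0) (hlt : ∀ k < m, y k = 0) : sInf {k : ℕ | z k ≠ 0} = m + t := by
  refine IsLeast.csInf_eq ⟨by simpa [hz] using hm, fun k hk => ?_⟩
  by_contra! h
  apply hk
  rw [hz]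
  split_ifs with hkt
  · rfl
  · exact hlt _ (by omega)

/-- Identification of delay-attack-free sensors. For a single-input
plant with `N` sensors at rest driven by an impulse, where sensor `j` has relative
degree `r j = 1 + min{ i : C_j Aⁱ B ≠ 0 }` and is subject to a delay attack of delay
`τ j` with first nonzero received-output time `σ j`, if at least one sensor is
attack-free then the set of minimizers of `j ↦ σ j − r j` is exactly the set of
delay-attack-free sensors `{ j : τ j = 0 }`, and the minimum value is `0`. -/
theorem statement11 {n N : ℕ}
    (A : Matrix (Fin n) (Fin n) ℝ) (B : Fin n → ℝ) (C : Fin N → Fin n → ℝ)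
    (x : ℕ → Fin n → ℝ) (u : ℕ → ℝ) (y : Fin N → ℕ → ℝ) (u₀ : ℝ) (hu₀ : u₀ ≠ 0)
    (hx0 : x 0 = 0)
    (hdyn : ∀ k, x (k + 1) = A.mulVec (x k) + u k • B)
    (hy : ∀ j k, y j k = C j ⬝ᵥ x k)
    (hu0 : u 0 = u₀) (hu : ∀ k, 1 ≤ k → u k = 0)
    (r : Fin N → ℕ) (hrpos : ∀ j, 1 ≤ r j)
    (hrdeg : ∀ j, C j ⬝ᵥ (A ^ (r j - 1)).mulVec B ≠ 0 ∧
      ∀ i, i < r j - 1 → C j ⬝ᵥ (A ^ i).mulVec B = 0)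
    (τ : Fin N → ℕ) (ytilde : Fin N → ℕ → ℝ)
    (hytilde : ∀ j k, ytilde j k = if k < τ j then 0 else y j (k - τ j))
    (σ : Fin N → ℕ) (hσ : ∀ j, σ j = sInf {k : ℕ | ytilde j k ≠ 0})
    (hfree : ∃ j, τ j = 0) :
    ({j : Fin N | ∀ j' : Fin N, (σ j : ℤ) - (r j : ℤ) ≤ (σ j' : ℤ) - (r j' : ℤ)} =
      {j : Fin N | τ j = 0}) ∧
    (∀ j, τ j = 0 → (σ j : ℤ) - (r j : ℤ) = 0) := by
  have hy0 : ∀ j, y j 0 = 0 := fun j => by simp [hy, hx0]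
  have hysucc : ∀ j k, y j (k + 1) = u₀ * (C j ⬝ᵥ (A ^ k).mulVec B) := fun j k => by
    rw [hy, state_impulse hx0 hdyn hu, hu0, dotProduct_smul, smul_eq_mul]
  have hfirst : ∀ j, σ j = r j + τ j := by
    intro j
    rw [hσ]
    refine sInf_delay_ne_zero (hytilde j) ?_ ?_
    · rw [← Nat.sub_add_cancel (hrpos j), hysucc]
      exact mul_ne_zero hu₀ (hrdeg j).1
    · rintro (_ | k) hk
      · exact hy0 j
      · rw [hysucc, (hrdeg j).2 k (by omega), mul_zero]
  refine ⟨?_, fun j hj => by simp [hfirst, hj]⟩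
  ext j
  simp only [Set.mem_ofPred_eq, hfirst]
  obtain ⟨j₀, hj₀⟩ := hfree
  constructor
  · intro h
    have := h j₀
    omega
  · intro h j'
    omega
end

section
/- Let A ∈ ℝ^{n×n}, B ∈ ℝ^{n×m}, C ∈ ℝ^{Q×n} with (A,B) controllable and (A,C) observable, and let offline attack-free data x, u satisfy x(k+1) = A x(k) + B u(k), z(k) = C x(k). Build Û ∈ ℝ^{m×T} with columns u(n),…,u(n+T−1), X̂₀ with columns 𝒳(n),…,𝒳(n+T−1), X̂₁ with columns 𝒳(n+1),…,𝒳(n+T), where 𝒳(k) = (z(k−n),…,z(k−1),u(k−n),…,u(k−1)) ∈ ℝ^{(Q+m)n}. Assume rank [Û; X̂₀] = m(n+1)+Qn, let G be a right inverse of [Û; X̂₀], and set Λ = X̂₁·G. Let (x', u') be any online trajectory of the same system with output z'(k) = C x'(k) and extended state 𝒳'(k), and fix k ≥ n. Suppose the operator's record of the history 𝒳'(k) and of the input u'(k) is attack-free, while the received extended state at time k+1 equals 𝒳̃(k+1), which coincides with 𝒳'(k+1) except that its newest output block z'(k) is replaced by z'(k) + a for some attack vector a ∈ ℝ^Q. Then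 the residual satisfies ‖𝒳̃(k+1) − Λ·(u'(k), 𝒳'(k))‖₂ = ‖a‖₂; in particular the residual is zero if and only if the measurement at time k is attack-free (a = 0). -/
open Matrix

/-- A matrix of full column rank has injective `mulVec`. -/
theorem eq_zero_of_mulVec_eq_zero_of_rank_eq {ι : Type*} [Fintype ι] {n : ℕ}
    (M : Matrix ι (Fin n) ℝ) (hM : M.rank = n) {v : Fin n → ℝ} (hv : M *ᵥ v = 0) : v = 0 := by
  have hdim := M.mulVecLin.finrank_range_add_finrank_ker
  have hr : Module.finrank ℝ (LinearMap.range M.mulVecLin) = n := hM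
  rw [hr, Module.finrank_fin_fun] at hdim
  have hker : LinearMap.ker M.mulVecLin = ⊥ := Submodule.finrank_eq_zero.mp (by omega)
  exact LinearMap.ker_eq_bot'.mp hker v hv

/-- For an observable pair, `n` vanishing outputs under vanishing input force the state
to vanish up to time `n`. -/
theorem state_eq_zero_of_output_eq_zero {n Q : ℕ} (A : Matrix (Fin n) (Fin n) ℝ)
    (C : Matrix (Fin Q) (Fin n) ℝ)
    (hobs : (Matrix.of fun (r : Fin n × Fin Q) (c : Fin n) =>
      (C * A ^ (r.1 : ℕ)) r.2 c).rank = n)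
    (y : ℕ → Fin n → ℝ) (hy : ∀ j < n, y (j + 1) = A *ᵥ y j)
    (hC : ∀ j < n, C *ᵥ y j = 0) {j : ℕ} (hj : j ≤ n) : y j = 0 := by
  have hpow : ∀ j ≤ n, y j = A ^ j *ᵥ y 0 := by
    intro j
    induction j with
    | zero => simp
    | succ j ih =>
      intro hj
      rw [hy j (by omega), ih (by omega), mulVec_mulVec, pow_succ']
  have h0 : y 0 = 0 := by
    apply eq_zero_of_mulVec_eq_zero_of_rank_eq _ hobs
    funext ⟨i, r⟩
    have h := congrFun (hC i i.2) r
    rw [hpow i i.2.le, mulVec_mulVec] at h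
    exact h
  rw [hpow j hj, h0, mulVec_zero]

/-- A combination of shifted input-output windows of one trajectory that matches a window of
another trajectory of an observable system also matches its next outputs. -/
theorem sum_output_eq_of_window_eq {n m Q T : ℕ}
    (A : Matrix (Fin n) (Fin n) ℝ) (B : Matrix (Fin n) (Fin m) ℝ)
    (C : Matrix (Fin Q) (Fin n) ℝ)
    (hobs : (Matrix.of fun (r : Fin n × Fin Q) (c : Fin n) =>
      (C * A ^ (r.1 : ℕ)) r.2 c).rank = n)
    (x x' : ℕ → Fin n → ℝ) (u u' : ℕ → Fin m → ℝ)
    (hdyn : ∀ k, x (k + 1) = A *ᵥ x k + B *ᵥ u k)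
    (hdyn' : ∀ k, x' (k + 1) = A *ᵥ x' k + B *ᵥ u' k)
    (g : Fin T → ℝ) (s : ℕ)
    (hu : ∀ j < n, ∑ t, g t • u (t + j) = u' (s + j))
    (hz : ∀ j < n, ∑ t, g t • C *ᵥ x (t + j) = C *ᵥ x' (s + j)) {j : ℕ} (hj : j ≤ n) :
    ∑ t, g t • C *ᵥ x (t + j) = C *ᵥ x' (s + j) := by
  have hsum : ∀ {p q : ℕ} (M : Matrix (Fin p) (Fin q) ℝ) (w : Fin T → Fin q → ℝ),
      M *ᵥ ∑ t, g t • w t = ∑ t, g t • M *ᵥ w t := fun M w => by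
    simp [mulVec_sum, mulVec_smul]
  have h := state_eq_zero_of_output_eq_zero A C hobs
    (fun j => ∑ t, g t • x (t + j) - x' (s + j))
    (fun j hj => by
      simp only [← add_assoc, hdyn, hdyn', smul_add, Finset.sum_add_distrib, mulVec_sub, hsum]
      rw [← hsum B, hu j hj]
      abel)
    (fun j hj => by simp only [mulVec_sub, hsum, hz j hj, sub_self]) hj
  rw [← hsum, sub_eq_zero.mp h]

/-- Residual of the data-driven detector under a data-injection
attack: if the offline attack-free data satisfies the rank condition, `G` is a right
inverse of `[Û; X̂₀]`, `Λ = X̂₁ G`, the history `𝒳'(k)` and input `u'(k)` are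
attack-free, and the received extended state `𝒳̃(k+1)` coincides with `𝒳'(k+1)`
except that its newest output block `z'(k)` is replaced by `z'(k) + a`, then the
residual satisfies `‖𝒳̃(k+1) − Λ (u'(k), 𝒳'(k))‖₂ = ‖a‖₂`; in particular the
residual is zero iff `a = 0`. -/
theorem statement12 {n m Q T : ℕ} (hn : 0 < n)
    (A : Matrix (Fin n) (Fin n) ℝ) (B : Matrix (Fin n) (Fin m) ℝ)
    (C : Matrix (Fin Q) (Fin n) ℝ)
    (hctrb : (Matrix.of fun (r : Fin n) (c : Fin n × Fin m) =>
      (A ^ (c.1 : ℕ) * B) r c.2).rank = n)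
    (hobs : (Matrix.of fun (r : Fin n × Fin Q) (c : Fin n) =>
      (C * A ^ (r.1 : ℕ)) r.2 c).rank = n)
    (x : ℕ → Fin n → ℝ) (u : ℕ → Fin m → ℝ) (z : ℕ → Fin Q → ℝ)
    (hdyn : ∀ k, x (k + 1) = A.mulVec (x k) + B.mulVec (u k))
    (hout : ∀ k, z k = C.mulVec (x k))
    (Uhat : Matrix (Fin m) (Fin T) ℝ) (hUhat : ∀ i t, Uhat i t = u (n + (t : ℕ)) i)
    (X₀hat : Matrix ((Fin n × Fin Q) ⊕ (Fin n × Fin m)) (Fin T) ℝ)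
    (hX₀hat : ∀ idx t, X₀hat idx t = extState n z u (n + (t : ℕ)) idx)
    (X₁hat : Matrix ((Fin n × Fin Q) ⊕ (Fin n × Fin m)) (Fin T) ℝ)
    (hX₁hat : ∀ idx t, X₁hat idx t = extState n z u (n + (t : ℕ) + 1) idx)
    (hrank : (Matrix.fromRows Uhat X₀hat).rank = m * (n + 1) + Q * n)
    (G : Matrix (Fin T) (Fin m ⊕ ((Fin n × Fin Q) ⊕ (Fin n × Fin m))) ℝ)
    (hG : Matrix.fromRows Uhat X₀hat * G = 1)
    (x' : ℕ → Fin n → ℝ) (u' : ℕ → Fin m → ℝ) (z' : ℕ → Fin Q → ℝ)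
    (hdyn' : ∀ k, x' (k + 1) = A.mulVec (x' k) + B.mulVec (u' k))
    (hout' : ∀ k, z' k = C.mulVec (x' k))
    (k : ℕ) (hk : n ≤ k)
    (a : Fin Q → ℝ)
    (Xtilde : (Fin n × Fin Q) ⊕ (Fin n × Fin m) → ℝ)
    (hXtilde : ∀ idx, Xtilde idx =
      match idx with
      | Sum.inl (i, rr) =>
          if (i : ℕ) + 1 = n then z' k rr + a rr
          else extState n z' u' (k + 1) (Sum.inl (i, rr))
      | Sum.inr q => extState n z' u' (k + 1) (Sum.inr q)) :
    Real.sqrt (∑ idx, (Xtilde idx -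
        (X₁hat * G).mulVec (Sum.elim (u' k) (extState n z' u' k)) idx) ^ 2) =
      Real.sqrt (∑ rr, a rr ^ 2) ∧
    (Real.sqrt (∑ idx, (Xtilde idx -
        (X₁hat * G).mulVec (Sum.elim (u' k) (extState n z' u' k)) idx) ^ 2) = 0 ↔
      a = 0) := by
  obtain ⟨g, hg⟩ : ∃ g, g = G *ᵥ Sum.elim (u' k) (extState n z' u' k) := ⟨_, rfl⟩
  have hW : Matrix.fromRows Uhat X₀hat *ᵥ g = Sum.elim (u' k) (extState n z' u' k) := by
    rw [hg, mulVec_mulVec, hG, one_mulVec]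
  have hU (i : Fin m) : ∑ t, g t * u (n + t) i = u' k i := by
    simpa [mulVec, dotProduct, hUhat, mul_comm] using congrFun hW (Sum.inl i)
  have hX (idx) : ∑ t : Fin T, g t * extState n z u (n + t) idx = extState n z' u' k idx := by
    simpa [mulVec, dotProduct, hX₀hat, mul_comm] using congrFun hW (Sum.inr idx)
  have hu : ∀ j ≤ n, ∑ t : Fin T, g t • u (t + j) = u' (k - n + j) := by
    intro j hj
    ext i
    rcases hj.lt_or_eq with hj | rfl
    · simpa [extState] using hX (Sum.inr (⟨j, hj⟩, i))
    · simpa [Nat.sub_add_cancel hk, add_comm] using hU i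
  have hz : ∀ j ≤ n, ∑ t : Fin T, g t • C *ᵥ x (t + j) = C *ᵥ x' (k - n + j) := fun j hj =>
    sum_output_eq_of_window_eq A B C hobs x x' u u' hdyn hdyn' g (k - n)
      (fun j hj => hu j hj.le)
      (fun j hj => by
        ext i
        simpa [extState, hout, hout'] using hX (Sum.inl (⟨j, hj⟩, i))) hj
  have hnext : (X₁hat * G) *ᵥ Sum.elim (u' k) (extState n z' u' k) =
      extState n z' u' (k + 1) := by
    rw [← mulVec_mulVec, ← hg]
    have hs : k + 1 - n = k - n + 1 := by omega
    have ht (t : ℕ) : n + t + 1 - n = t + 1 := by omega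
    ext (⟨i, r⟩ | ⟨i, r⟩)
    · have h := congrFun (hz (i + 1) i.2) r
      simpa [mulVec, dotProduct, hX₁hat, extState, hs, ht, hout, hout', mul_comm, add_assoc,
        add_comm 1, Finset.sum_apply] using h
    · have h := congrFun (hu (i + 1) i.2) r
      simpa [mulVec, dotProduct, hX₁hat, extState, hs, ht, mul_comm, add_assoc, add_comm 1,
        Finset.sum_apply] using h
  have hres : ∑ idx, (Xtilde idx -
      (X₁hat * G).mulVec (Sum.elim (u' k) (extState n z' u' k)) idx) ^ 2 =
      ∑ r, a r ^ 2 := by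
    obtain ⟨p, rfl⟩ : ∃ p, n = p + 1 := ⟨n - 1, by omega⟩
    have hlast : k - p + p = k := by omega
    rw [hnext, Fintype.sum_sum_type, Fintype.sum_prod_type,
      Finset.sum_eq_single (Fin.last p)]
    · simp [hXtilde, extState, hlast]
    · intro i _ hi
      have hi' : (i : ℕ) ≠ p := fun h => hi (Fin.ext h)
      simp [hXtilde, hi']
    · simp
  rw [hres]
  refine ⟨rfl, ?_⟩
  rw [Real.sqrt_eq_zero (Finset.sum_nonneg fun r _ => sq_nonneg (a r)),
    Finset.sum_eq_zero_iff_of_nonneg fun r _ => sq_nonneg (a r)]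
  simp [funext_iff]
end

section
/- Let A ∈ ℝ^{n×n}, B ∈ ℝ^{n×m} with (A,B) controllable, and let x : ℕ → ℝ^n, u : ℕ → ℝ^m satisfy x(k+1) = A x(k) + B u(k) for all k. Let L ≥ 1 and T ≥ n + L, and suppose the input segment u(0),…,u(T−1) is persistently exciting of order n+L, i.e., the Hankel matrix of depth n+L of u starting at 0 with T−(n+L)+1 columns has rank m(n+L). Then the stacked matrix [U_{0,L}; X₀] ∈ ℝ^{(mL+n)×(T−L+1)} has rank mL + n, where U_{0,L} is the Hankel matrix of depth L of u starting at 0 with T−L+1 columns and X₀ ∈ ℝ^{n×(T−L+1)} is the matrix with columns x(0),…,x(T−L). -/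
open Matrix

/-- A matrix has full row rank exactly when its left kernel is trivial. -/
theorem rank_eq_card_rows_iff {ι κ : Type*} [Fintype ι] [Fintype κ] (M : Matrix ι κ ℝ) :
    M.rank = Fintype.card ι ↔ ∀ v : ι → ℝ, v ᵥ* M = 0 → v = 0 := by
  rw [Matrix.rank_eq_finrank_span_row, eq_comm, ← Set.finrank,
    ← linearIndependent_iff_card_eq_finrank_span, ← Matrix.vecMul_injective_iff]
  exact injective_iff_map_eq_zero (Matrix.vecMulLinear M)

theorem vecMul_hankel {q : ℕ} (w : ℕ → Fin q → ℝ) (i t N : ℕ) (ξ : ℕ → Fin q → ℝ)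
    (c : Fin N) :
    ((fun p : Fin t × Fin q => ξ p.1 p.2) ᵥ* hankel w i t N) c =
      ∑ k ∈ Finset.range t, ξ k ⬝ᵥ w (i + k + c) := by
  simp only [vecMul, dotProduct, hankel, Matrix.of_apply, Fintype.sum_prod_type]
  exact Fin.sum_univ_eq_sum_range (fun k => ∑ b, ξ k b * w (i + k + c) b) t

/-- Coefficients of the functional `∑ k, ξ k ⬝ᵥ u (c + k) + η ⬝ᵥ x c`, delayed by `j` steps along
`x (k + 1) = A x k + B u k`, in terms of the inputs `u c, u (c + 1), …` and the state `x c`. -/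
def delayedCoeff {n m : ℕ} (A : Matrix (Fin n) (Fin n) ℝ) (B : Matrix (Fin n) (Fin m) ℝ)
    (ξ : ℕ → Fin m → ℝ) (η : Fin n → ℝ) : ℕ → ℕ → Fin m → ℝ
  | 0, k => ξ k
  | j + 1, 0 => η ᵥ* (A ^ j * B)
  | j + 1, k + 1 => delayedCoeff A B ξ η j k

section delayedCoeff

variable {n m : ℕ} (A : Matrix (Fin n) (Fin n) ℝ) (B : Matrix (Fin n) (Fin m) ℝ)
  (ξ : ℕ → Fin m → ℝ) (η : Fin n → ℝ)

theorem delayedCoeff_add (j k : ℕ) : delayedCoeff A B ξ η j (k + j) = ξ k := by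
  induction j with
  | zero => simp [delayedCoeff]
  | succ j ih => rw [← add_assoc, delayedCoeff, ih]

theorem delayedCoeff_add_succ (i k : ℕ) :
    delayedCoeff A B ξ η (i + k + 1) k = η ᵥ* (A ^ i * B) := by
  induction k with
  | zero => simp [delayedCoeff]
  | succ k ih => rw [← add_assoc, delayedCoeff, ih]

theorem sum_delayedCoeff {x : ℕ → Fin n → ℝ} {u : ℕ → Fin m → ℝ}
    (hdyn : ∀ k, x (k + 1) = A *ᵥ x k + B *ᵥ u k) (L j c : ℕ) :
    ∑ k ∈ Finset.range (L + j), delayedCoeff A B ξ η j k ⬝ᵥ u (c + k) +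
        η ᵥ* A ^ j ⬝ᵥ x c =
      ∑ k ∈ Finset.range L, ξ k ⬝ᵥ u (c + j + k) + η ⬝ᵥ x (c + j) := by
  induction j generalizing c with
  | zero => simp [delayedCoeff]
  | succ j ih =>
    have h := ih (c + 1)
    rw [hdyn, dotProduct_add, dotProduct_mulVec, dotProduct_mulVec, vecMul_vecMul,
      vecMul_vecMul, ← pow_succ] at h
    rw [← add_assoc, Finset.sum_range_succ']
    simp only [delayedCoeff, add_zero]
    rw [show c + (j + 1) = c + 1 + j by ring, ← h]
    simp only [add_assoc, add_comm 1]
    ring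

/-- By Cayley-Hamilton, weighting the delayed functionals by the coefficients of the
characteristic polynomial of `A` eliminates the state. -/
theorem sum_charpoly_delayedCoeff {x : ℕ → Fin n → ℝ} {u : ℕ → Fin m → ℝ}
    (hdyn : ∀ k, x (k + 1) = A *ᵥ x k + B *ᵥ u k) {L c : ℕ}
    (hξ : ∀ k, L ≤ k → ξ k = 0)
    (h : ∀ j ≤ n, ∑ k ∈ Finset.range L, ξ k ⬝ᵥ u (c + j + k) + η ⬝ᵥ x (c + j) = 0) :
    ∑ k ∈ Finset.range (n + L),
      (∑ j ∈ Finset.range (n + 1), A.charpoly.coeff j • delayedCoeff A B ξ η j k) ⬝ᵥ u (c + k)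
        = 0 := by
  have hdelay : ∀ j ∈ Finset.range (n + 1),
      ∑ k ∈ Finset.range (n + L), delayedCoeff A B ξ η j k ⬝ᵥ u (c + k) =
        -(η ᵥ* A ^ j ⬝ᵥ x c) := by
    intro j hj
    have hj : j ≤ n := Nat.lt_succ_iff.mp (Finset.mem_range.mp hj)
    rw [eq_neg_iff_add_eq_zero, ← h j hj, ← sum_delayedCoeff A B ξ η hdyn L j c]
    congr 1
    symm
    apply Finset.sum_subset (Finset.range_subset_range.mpr (by omega))
    intro k _ hk
    obtain ⟨i, rfl⟩ := Nat.exists_eq_add_of_le' (show j ≤ k by simp at hk; omega)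
    rw [delayedCoeff_add, hξ i (by simp at hk; omega), zero_dotProduct]
  have hCH : ∑ j ∈ Finset.range (n + 1), A.charpoly.coeff j • A ^ j = 0 := by
    rw [← A.aeval_self_charpoly, Polynomial.aeval_eq_sum_range, A.charpoly_natDegree_eq_dim,
      Fintype.card_fin]
  simp only [sum_dotProduct, smul_dotProduct]
  rw [Finset.sum_comm]
  simp only [← Finset.smul_sum]
  rw [Finset.sum_congr rfl fun j hj => by rw [hdelay j hj]]
  simp only [smul_neg, Finset.sum_neg_distrib, ← smul_dotProduct, ← vecMul_smul,
    ← sum_dotProduct]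
  rw [← vecMul_sum, hCH, vecMul_zero, zero_dotProduct, neg_zero]

theorem charpoly_coeff_card : A.charpoly.coeff n = 1 := by
  simpa [Polynomial.Monic, Polynomial.leadingCoeff, A.charpoly_natDegree_eq_dim] using
    A.charpoly_monic

theorem eq_zero_of_sum_charpoly_delayedCoeff {L : ℕ} (hξ : ∀ k, L ≤ k → ξ k = 0)
    (h : ∀ k < n + L,
      ∑ j ∈ Finset.range (n + 1), A.charpoly.coeff j • delayedCoeff A B ξ η j k = 0) :
    (∀ k, ξ k = 0) ∧ ∀ i < n, η ᵥ* (A ^ i * B) = 0 := by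
  have hlast : ∀ k < n + L, (∀ j < n, delayedCoeff A B ξ η j k = 0) →
      delayedCoeff A B ξ η n k = 0 := by
    intro k hk hj
    have hs := h k hk
    rwa [Finset.sum_range_succ, charpoly_coeff_card, one_smul,
      Finset.sum_eq_zero fun j hjn => by rw [hj j (Finset.mem_range.mp hjn), smul_zero],
      zero_add] at hs
  have hzero : ∀ d k, L ≤ k + d → ξ k = 0 := by
    intro d
    induction d with
    | zero => exact hξ
    | succ d ih =>
      intro k hk
      rcases le_or_gt L k with hLk | hkL
      · exact hξ k hLk
      rw [← delayedCoeff_add A B ξ η n k]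
      refine hlast _ (by omega) fun j hj => ?_
      rw [show k + n = k + n - j + j by omega, delayedCoeff_add]
      exact ih _ (by omega)
  have hξ0 : ∀ k, ξ k = 0 := fun k => hzero L k (by omega)
  refine ⟨hξ0, fun i => ?_⟩
  induction i using Nat.strong_induction_on with
  | _ i ih =>
    intro hi
    obtain ⟨k, rfl⟩ : ∃ k, n = i + k + 1 := ⟨n - 1 - i, by omega⟩
    rw [← delayedCoeff_add_succ A B ξ η i k]
    refine hlast k (by omega) fun j hj => ?_
    rcases le_or_gt j k with hjk | hkj
    · obtain ⟨l, rfl⟩ := Nat.exists_eq_add_of_le' hjk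
      rw [delayedCoeff_add, hξ0]
    · obtain ⟨l, rfl⟩ : ∃ l, j = l + k + 1 := ⟨j - 1 - k, by omega⟩
      rw [delayedCoeff_add_succ]
      exact ih l (by omega) (by omega)

end delayedCoeff

/-- (Fundamental lemma, input-state version.) If `(A, B)` is
controllable and the input segment `u(0), …, u(T−1)` is persistently exciting of
order `n + L`, then the stacked matrix `[U_{0,L}; X₀]` — the depth-`L` input Hankel
matrix on top of the state sequence `x(0), …, x(T−L)` — has full row rank `mL + n`. -/
theorem statement13 {n m L T : ℕ} (hL : 1 ≤ L) (hT : n + L ≤ T)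
    (A : Matrix (Fin n) (Fin n) ℝ) (B : Matrix (Fin n) (Fin m) ℝ)
    (hctrb : (Matrix.of fun (r : Fin n) (c : Fin n × Fin m) =>
      (A ^ (c.1 : ℕ) * B) r c.2).rank = n)
    (x : ℕ → Fin n → ℝ) (u : ℕ → Fin m → ℝ)
    (hdyn : ∀ k, x (k + 1) = A.mulVec (x k) + B.mulVec (u k))
    (hPE : (hankel u 0 (n + L) (T - (n + L) + 1)).rank = m * (n + L))
    (X₀ : Matrix (Fin n) (Fin (T - L + 1)) ℝ) (hX₀ : ∀ i t, X₀ i t = x (t : ℕ) i) :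
    (Matrix.fromRows (hankel u 0 L (T - L + 1)) X₀).rank = m * L + n := by
  have hctrb' := (rank_eq_card_rows_iff _).mp (hctrb.trans (Fintype.card_fin n).symm)
  have hPE' := (rank_eq_card_rows_iff _).mp
    (hPE.trans (show m * (n + L) = Fintype.card (Fin (n + L) × Fin m) by simp [mul_comm]))
  rw [show m * L + n = Fintype.card ((Fin L × Fin m) ⊕ Fin n) by simp [mul_comm],
    rank_eq_card_rows_iff]
  intro v hv
  obtain ⟨η, hη⟩ : ∃ η : Fin n → ℝ, v ∘ Sum.inr = η := ⟨_, rfl⟩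
  let ξ : ℕ → Fin m → ℝ := fun k b => if hk : k < L then v (Sum.inl (⟨k, hk⟩, b)) else 0
  have hξ : ∀ k, L ≤ k → ξ k = 0 := fun k hk => by
    ext b
    simp [ξ, not_lt.mpr hk]
  have hvξ : v ∘ Sum.inl = fun p : Fin L × Fin m => ξ p.1 p.2 := by
    ext p
    simp [ξ]
  have hann : ∀ c < T - L + 1, ∑ k ∈ Finset.range L, ξ k ⬝ᵥ u (c + k) + η ⬝ᵥ x c = 0 := by
    intro c hc
    have h := congrFun hv ⟨c, hc⟩
    rw [vecMul_fromRows, hvξ, hη, Pi.add_apply, vecMul_hankel] at h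
    simpa [vecMul, dotProduct, hX₀, add_comm] using h
  have hg := hPE'
    (fun p => (∑ j ∈ Finset.range (n + 1),
      A.charpoly.coeff j • delayedCoeff A B ξ η j p.1) p.2) (by
    ext c
    rw [vecMul_hankel u 0 (n + L) _ fun k => ∑ j ∈ Finset.range (n + 1),
      A.charpoly.coeff j • delayedCoeff A B ξ η j k]
    have h := sum_charpoly_delayedCoeff A B ξ η hdyn (c := c) hξ
      fun j hj => hann (c + j) (by omega)
    simpa [add_comm] using h)
  obtain ⟨hξ0, hη0⟩ := eq_zero_of_sum_charpoly_delayedCoeff A B ξ η hξ fun k hk => by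
    ext b
    exact congrFun hg (⟨k, hk⟩, b)
  have hη1 : η = 0 := hctrb' η (by
    ext p
    exact congrFun (hη0 p.1 p.1.isLt) p.2)
  ext (p | r)
  · have h := congrFun hvξ p
    simpa [hξ0] using h
  · exact congrFun (hη.trans hη1) r
end
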